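/- Let n ≥ 1 and let 𝒯 = {K_1, …, K_q} be a triangle patch around a point z ∈ ℝ². If u is a real bivariate polynomial of total degree ≤ n such that for every i ∈ {1, …, q} the restriction of u to K_i is orthogonal to P_{n−1}(K_i) with respect to (·,·)_{K_i}, then u = 0. Equivalently, the intersection ⋂_{i=1}^q P_{n−1}^⊥(K_i), taken inside the space of bivariate polynomials of total degree ≤ n (each polynomial being determined by its restriction to any triangle), is the zero space. -/

import Mathlib

open MeasureTheory Finset

noncomputable section

/-- 2×2 determinant of two vectors in `ℝ²`. -/
def det2 (u v : ℝ × ℝ) : ℝ := u.1 * v.2 - u.2 * v.1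

/-- The open triangle with vertices `A`, `B`, `C` (interior of the convex hull). -/
def tri (A B C : ℝ × ℝ) : Set (ℝ × ℝ) := interior (convexHull ℝ {A, B, C})

/-- Barycentric coordinate of `p` with respect to the vertex `A` of triangle `ABC`. -/
def bary (A B C p : ℝ × ℝ) : ℝ := det2 (p - B) (C - B) / det2 (A - B) (C - B)

/-- The cubic bubble: product of the three barycentric coordinates of triangle `ABC`. -/
def bubble (A B C p : ℝ × ℝ) : ℝ := bary A B C p * bary B C A p * bary C A B p

/-- Evaluation of a bivariate polynomial at a point of `ℝ²`. -/
def evalP (u : MvPolynomial (Fin 2) ℝ) (p : ℝ × ℝ) : ℝ :=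
  MvPolynomial.eval ![p.1, p.2] u

/-- The inner product `(u,v)_K := ∫_K u v ω_K` on the open triangle `K = conv°(A,B,C)`,
with weight the product of the barycentric coordinates. -/
def innerT (A B C : ℝ × ℝ) (u v : MvPolynomial (Fin 2) ℝ) : ℝ :=
  ∫ p in tri A B C, evalP u p * evalP v p * bubble A B C p

/-- `u ∈ P_{n-1}^⊥(K)` for `K = conv°(A,B,C)`: `u` has total degree at most `n` and is
orthogonal to every polynomial of total degree at most `n-1` w.r.t. `(·,·)_K`. -/
def inPerp (n : ℕ) (A B C : ℝ × ℝ) (u : MvPolynomial (Fin 2) ℝ) : Prop :=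
  u.totalDegree ≤ n ∧
    ∀ w : MvPolynomial (Fin 2) ℝ, w.totalDegree ≤ n - 1 → innerT A B C u w = 0

/-- A triangle patch around a point `z`: `q ≥ 3` pairwise disjoint nondegenerate open
triangles `K_i = conv°(z, A_{i-1}, A_i)` (indices cyclic, i.e. in `ZMod q`), consecutive ones
sharing the edge from `z` to `A_i`, whose closed union covers a neighbourhood of `z`. -/
structure TrianglePatch (q : ℕ) where
  hq : 3 ≤ q
  z : ℝ × ℝ
  A : ZMod q → ℝ × ℝ
  indep : ∀ i : ZMod q, AffineIndependent ℝ ![z, A (i - 1), A i]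
  disj : Pairwise fun i j : ZMod q =>
    Disjoint (tri z (A (i - 1)) (A i)) (tri z (A (j - 1)) (A j))
  covers : ∃ ε > 0, Metric.ball z ε ⊆ ⋃ i : ZMod q, closure (tri z (A (i - 1)) (A i))

/-- The `i`-th triangle of a patch. -/
def TrianglePatch.K {q : ℕ} (T : TrianglePatch q) (i : ZMod q) : Set (ℝ × ℝ) :=
  tri T.z (T.A (i - 1)) (T.A i)

/-- `Ω`: the interior of the union of the closed triangles of the patch. -/
def TrianglePatch.Omega {q : ℕ} (T : TrianglePatch q) : Set (ℝ × ℝ) :=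
  interior (⋃ i : ZMod q, closure (tri T.z (T.A (i - 1)) (T.A i)))

/-- The patch inner product `(u,v)_𝒯 = Σ_i (u_i, v_i)_{K_i}` of two piecewise polynomials
(given as tuples of polynomials, one for each triangle). -/
def patchInner {q : ℕ} (T : TrianglePatch q)
    (u v : ZMod q → MvPolynomial (Fin 2) ℝ) : ℝ :=
  haveI : NeZero q := ⟨by have := T.hq; omega⟩
  ∑ i : ZMod q, innerT T.z (T.A (i - 1)) (T.A i) (u i) (v i)

open Polynomial in
/-- Integration of a real polynomial over `[0, 1]`, as a linear functional. -/
def unitIntegral : ℝ[X] →ₗ[ℝ] ℝ where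
  toFun p := ∫ x in (0 : ℝ)..1, p.eval x
  map_add' p q := by
    simp only [eval_add]
    exact intervalIntegral.integral_add (p.continuous.intervalIntegrable _ _)
      (q.continuous.intervalIntegrable _ _)
  map_smul' c p := by
    simp [eval_smul, intervalIntegral.integral_const_mul]

section Univariate

open Polynomial

theorem unitIntegral_apply (p : ℝ[X]) : unitIntegral p = ∫ x in (0 : ℝ)..1, p.eval x := rfl

theorem unitIntegral_eq_setIntegral (p : ℝ[X]) :
    unitIntegral p = ∫ x in Set.Ioo (0 : ℝ) 1, p.eval x := by
  rw [unitIntegral_apply, intervalIntegral.integral_of_le zero_le_one, MeasureTheory.integral_Ioc_eq_integral_Ioo]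

theorem unitIntegral_derivative (p : ℝ[X]) :
    unitIntegral (derivative p) = p.eval 1 - p.eval 0 := by
  rw [unitIntegral_apply]
  exact intervalIntegral.integral_eq_sub_of_hasDerivAt (fun x _ => p.hasDerivAt x)
    ((derivative p).continuous.intervalIntegrable _ _)

theorem one_sub_X_ne_zero : (1 - X : ℝ[X]) ≠ 0 := by
  intro h
  simpa using congrArg (eval 0) h

theorem eq_zero_of_eval_eq_zero_on_Ioo {p : ℝ[X]} (h : ∀ x ∈ Set.Ioo (0 : ℝ) 1, p.eval x = 0) :
    p = 0 :=
  p.eq_zero_of_infinite_isRoot ((Set.Ioo_infinite zero_lt_one).mono h)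

theorem eq_zero_of_unitIntegral_eq_zero {p : ℝ[X]} (h0 : ∀ x ∈ Set.Ioo (0 : ℝ) 1, 0 ≤ p.eval x)
    (h : unitIntegral p = 0) : p = 0 := by
  refine eq_zero_of_eval_eq_zero_on_Ioo fun x hx => ?_
  by_contra hne
  have h0' : ∀ x ∈ Set.Icc (0 : ℝ) 1, 0 ≤ p.eval x := by
    rw [← closure_Ioo (zero_ne_one' ℝ)]
    exact fun x hx => closure_minimal h0 (isClosed_le continuous_const p.continuous) hx
  have := intervalIntegral.integral_pos zero_lt_one p.continuousOn
    (fun x hx => h0' x (Set.Ioc_subset_Icc_self hx))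
    ⟨x, Set.Ioo_subset_Icc_self hx, lt_of_le_of_ne (h0 x hx) (Ne.symm hne)⟩
  exact this.ne' h

/-- A polynomial vanishing to order `j + 1` at `0` and orthogonal to `X ^ j * T` for the weight
`x ^ 3 * (1 - x)`, for all `T` of degree `< n - j`, is zero. -/
theorem eq_zero_of_X_pow_dvd {n j : ℕ} {P : ℝ[X]} (hP : P.natDegree ≤ n)
    (hdvd : X ^ (j + 1) ∣ P)
    (h : ∀ T : ℝ[X], T.natDegree + j < n → unitIntegral (X ^ 3 * (1 - X) * (X ^ j * T * P)) = 0) :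
    P = 0 := by
  obtain ⟨Q, rfl⟩ := hdvd
  by_contra hne
  have hQ : Q ≠ 0 := right_ne_zero_of_mul hne
  rw [natDegree_mul (pow_ne_zero _ X_ne_zero) hQ, natDegree_X_pow] at hP
  have := eq_zero_of_unitIntegral_eq_zero ?_ (h Q (by omega))
  · simp [hQ, one_sub_X_ne_zero] at this
  · rintro x ⟨hx0, hx1⟩
    have h1 : 0 ≤ 1 - x := by linarith
    have : eval x (X ^ 3 * (1 - X) * (X ^ j * Q * (X ^ (j + 1) * Q))) =
        x ^ 3 * (1 - x) * (x ^ j * x ^ (j + 1) * (eval x Q) ^ 2) := by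
      simp only [eval_mul, eval_pow, eval_sub, eval_one, eval_X]; ring
    rw [this]; positivity

theorem eq_zero_of_coeff_one_eq_zero {n : ℕ} (hn : 1 ≤ n) {P : ℝ[X]} (hP : P.natDegree ≤ n)
    (h1 : P.coeff 1 = 0)
    (h : ∀ T : ℝ[X], T.natDegree < n → unitIntegral (X ^ 3 * (1 - X) * (T * P)) = 0) :
    P = 0 := by
  have hd : derivative P = 0 := by
    obtain ⟨R, hR⟩ : X ∣ derivative P := by
      rw [X_dvd_iff, coeff_derivative]; simp [h1]
    rcases eq_or_ne R 0 with h0 | h0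
    · rw [hR, h0, mul_zero]
    have hRn : R.natDegree + 1 ≤ n - 1 := by
      have := natDegree_derivative_le P
      rw [hR, natDegree_mul X_ne_zero h0, natDegree_X] at this
      omega
    set T := derivative R * (X * (1 - X)) + R * (4 * (1 - X) - 2 * X) with hT
    have hdR := natDegree_derivative_le R
    have hTn : T.natDegree < n := by
      rw [hT]
      have a1 : (derivative R * (X * (1 - X))).natDegree ≤ R.natDegree + 1 := by
        rcases eq_or_ne R.natDegree 0 with h | h
        · rw [natDegree_eq_zero] at h
          obtain ⟨c, rfl⟩ := h
          simp
        · refine natDegree_mul_le.trans ?_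
          have : (X * (1 - X) : ℝ[X]).natDegree ≤ 2 := by compute_degree
          omega
      have a2 : (R * (4 * (1 - X) - 2 * X)).natDegree ≤ R.natDegree + 1 := by
        refine natDegree_mul_le.trans ?_
        have : (4 * (1 - X) - 2 * X : ℝ[X]).natDegree ≤ 1 := by compute_degree
        omega
      have := (natDegree_add_le _ _).trans (max_le a1 a2)
      omega
    have key := unitIntegral_derivative (P * (R * (X ^ 4 * (1 - X) ^ 2)))
    have e : derivative (P * (R * (X ^ 4 * (1 - X) ^ 2))) =
        X ^ 5 * (1 - X) ^ 2 * R ^ 2 + X ^ 3 * (1 - X) * (T * P) := by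
      rw [derivative_mul, hR, hT]
      simp only [derivative_mul, derivative_pow, derivative_sub, derivative_one, derivative_X,
        map_ofNat, Nat.cast_ofNat]
      ring
    rw [e, map_add, h T hTn] at key
    simp only [add_zero, eval_mul, eval_pow, eval_sub, eval_one, eval_X] at key
    have := eq_zero_of_unitIntegral_eq_zero ?_ (key.trans (by norm_num))
    · simp [h0, one_sub_X_ne_zero] at this
    · rintro x ⟨hx0, hx1⟩
      simp only [eval_mul, eval_pow, eval_sub, eval_one, eval_X]
      positivity
  have hC : P = C (P.coeff 0) := eq_C_of_natDegree_eq_zero (derivative_eq_zero.mp hd)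
  have h2 := h P (by rw [hC, natDegree_C]; omega)
  have := eq_zero_of_unitIntegral_eq_zero ?_ h2
  · simpa [one_sub_X_ne_zero] using this
  · rintro x ⟨hx0, hx1⟩
    have h1 : 0 ≤ 1 - x := by linarith
    simp only [eval_mul, eval_pow, eval_sub, eval_one, eval_X]
    have := mul_self_nonneg (eval x P)
    positivity

/-- The roots of a nonzero polynomial of degree `≤ k` orthogonal to all polynomials of degree `< k`
for the weight `x * (1 - x)` lie in `(0, 1)`. -/
theorem mem_Ioo_of_isRoot {k : ℕ} {p : ℝ[X]} (hp : p ≠ 0) (hk : p.natDegree ≤ k)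
    (h : ∀ G : ℝ[X], G.natDegree < k → unitIntegral (X * (1 - X) * (p * G)) = 0)
    {s : ℝ} (hs : p.IsRoot s) : s ∈ Set.Ioo (0 : ℝ) 1 := by
  obtain ⟨g, rfl⟩ := dvd_iff_isRoot.mpr hs
  have hg : g ≠ 0 := right_ne_zero_of_mul hp
  rw [natDegree_mul (X_sub_C_ne_zero s) hg, natDegree_X_sub_C] at hk
  have hgk := h g (by omega)
  have ev (x : ℝ) : eval x (X * (1 - X) * ((X - C s) * g * g)) =
      x * (1 - x) * (eval x g) ^ 2 * (x - s) := by simp; ring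
  by_contra hs'
  rw [Set.mem_Ioo, not_and_or, not_lt, not_lt] at hs'
  have hne : X * (1 - X) * ((X - C s) * g * g) ≠ 0 := by
    simp [one_sub_X_ne_zero, hg, X_sub_C_ne_zero]
  rcases hs' with hs' | hs'
  · refine hne (eq_zero_of_unitIntegral_eq_zero ?_ hgk)
    rintro x ⟨hx0, hx1⟩
    rw [ev]
    have h1 : 0 ≤ 1 - x := by linarith
    have h2 : 0 ≤ x - s := by linarith
    positivity
  · refine hne (neg_eq_zero.mp (eq_zero_of_unitIntegral_eq_zero ?_ (by rw [map_neg, hgk, neg_zero])))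
    rintro x ⟨hx0, hx1⟩
    rw [eval_neg, ev, ← mul_neg]
    have h1 : 0 ≤ 1 - x := by linarith
    have h2 : 0 ≤ -(x - s) := by linarith
    positivity

theorem natDegree_eq_of_orthogonal {k : ℕ} {p : ℝ[X]} (hp : p ≠ 0) (hk : p.natDegree ≤ k)
    (h : ∀ G : ℝ[X], G.natDegree < k → unitIntegral (X * (1 - X) * (p * G)) = 0) :
    p.natDegree = k := by
  by_contra hne
  have := eq_zero_of_unitIntegral_eq_zero ?_ (h p (by omega))
  · simp [one_sub_X_ne_zero, hp] at this
  · rintro x ⟨hx0, hx1⟩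
    have h1 : 0 ≤ 1 - x := by linarith
    simp only [eval_mul, eval_sub, eval_one, eval_X]
    have := mul_self_nonneg (eval x p)
    positivity

theorem exists_root_of_orthogonal_one {p : ℝ[X]} (h : unitIntegral (X * (1 - X) * p) = 0) :
    ∃ s ∈ Set.Ioo (0 : ℝ) 1, p.eval s = 0 := by
  by_contra! hne
  have hp : p ≠ 0 := by
    rintro rfl
    exact hne (1 / 2) (by norm_num) eval_zero
  have hX : X * (1 - X) * p ≠ 0 := by simp [one_sub_X_ne_zero, hp]
  have hsign : (∀ x ∈ Set.Ioo (0 : ℝ) 1, 0 < p.eval x) ∨ ∀ x ∈ Set.Ioo (0 : ℝ) 1, p.eval x < 0 := by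
    by_contra! hcon
    obtain ⟨⟨x, hx, hpx⟩, y, hy, hpy⟩ := hcon
    obtain ⟨s, hs, hs0⟩ := isPreconnected_Ioo.intermediate_value hx hy p.continuousOn ⟨hpx, hpy⟩
    exact hne s hs hs0
  rcases hsign with hs | hs
  · refine hX (eq_zero_of_unitIntegral_eq_zero ?_ h)
    rintro x ⟨hx0, hx1⟩
    have h1 : 0 ≤ 1 - x := by linarith
    have h2 := (hs x ⟨hx0, hx1⟩).le
    simp only [eval_mul, eval_sub, eval_one, eval_X]
    positivity
  · refine hX (neg_eq_zero.mp (eq_zero_of_unitIntegral_eq_zero ?_ (by rw [map_neg, h, neg_zero])))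
    rintro x ⟨hx0, hx1⟩
    have h1 : 0 ≤ 1 - x := by linarith
    have h2 : 0 ≤ -eval x p := by linarith [hs x ⟨hx0, hx1⟩]
    simp only [eval_neg, eval_mul, eval_sub, eval_one, eval_X, ← mul_neg]
    positivity

end Univariate

section PlanePolynomials

open MvPolynomial

theorem totalDegree_aeval_le {F : MvPolynomial (Fin 2) ℝ} {n : ℕ} (hF : F.totalDegree ≤ n)
    {f : Fin 2 → MvPolynomial (Fin 2) ℝ} (hf : ∀ i, (f i).totalDegree ≤ 1) :
    (aeval f F).totalDegree ≤ n := by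
  rw [aeval_def, eval₂_eq']
  refine totalDegree_finsetSum_le fun d hd => ?_
  refine (totalDegree_mul _ _).trans ?_
  rw [algebraMap_eq, totalDegree_C, zero_add, Fin.prod_univ_two]
  have hdn := (le_totalDegree hd).trans hF
  rw [Finsupp.sum_fintype _ _ (fun _ => rfl), Fin.sum_univ_two] at hdn
  refine (totalDegree_mul _ _).trans (le_trans (add_le_add ?_ ?_) hdn) <;>
  exact (totalDegree_pow _ _).trans (by nlinarith [hf 0, hf 1])

/-- The polynomial `v ↦ F (z + v)`. -/
def translateP (z : ℝ × ℝ) (F : MvPolynomial (Fin 2) ℝ) : MvPolynomial (Fin 2) ℝ :=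
  aeval ![X 0 + C z.1, X 1 + C z.2] F

theorem evalP_translateP (z v : ℝ × ℝ) (F : MvPolynomial (Fin 2) ℝ) :
    evalP (translateP z F) v = evalP F (z + v) := by
  unfold evalP translateP
  change aeval _ _ = aeval _ F
  rw [← AlgHom.comp_apply, comp_aeval]
  congr 2
  ext i
  fin_cases i <;> simp [add_comm]

theorem totalDegree_translateP_le (z : ℝ × ℝ) {F : MvPolynomial (Fin 2) ℝ} {n : ℕ}
    (hF : F.totalDegree ≤ n) : (translateP z F).totalDegree ≤ n := by
  refine totalDegree_aeval_le hF fun i => ?_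
  fin_cases i <;> exact (totalDegree_add _ _).trans (by simp)

theorem eq_zero_of_evalP_eq_zero {F : MvPolynomial (Fin 2) ℝ} (h : ∀ v, evalP F v = 0) : F = 0 := by
  refine funext fun x => ?_
  have := h (x 0, x 1)
  rw [map_zero, ← this, evalP]
  congr 2
  ext i
  fin_cases i <;> rfl

theorem eq_zero_of_translateP_eq_zero {z : ℝ × ℝ} {F : MvPolynomial (Fin 2) ℝ}
    (h : translateP z F = 0) : F = 0 := by
  refine eq_zero_of_evalP_eq_zero fun v => ?_
  have := evalP_translateP z (v - z) F
  rw [h, add_sub_cancel] at this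
  rw [← this, evalP, map_zero]

theorem evalP_eq_sum_monomials (F : MvPolynomial (Fin 2) ℝ) (v : ℝ × ℝ) :
    evalP F v = ∑ d ∈ F.support, F.coeff d * (v.1 ^ d 0 * v.2 ^ d 1) := by
  simp [evalP, eval_eq']

theorem IsHomogeneous.add_eq {F : MvPolynomial (Fin 2) ℝ} {k : ℕ} (hF : F.IsHomogeneous k)
    {d : Fin 2 →₀ ℕ} (hd : d ∈ F.support) : d 0 + d 1 = k := by
  have := hF (mem_support_iff.mp hd)
  rwa [Finsupp.weight_apply, Finsupp.sum_fintype _ _ (by simp), Fin.sum_univ_two,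
    Pi.one_apply, Pi.one_apply, smul_eq_mul, smul_eq_mul, mul_one, mul_one] at this

theorem IsHomogeneous.evalP_smul {F : MvPolynomial (Fin 2) ℝ} {k : ℕ} (hF : F.IsHomogeneous k)
    (r : ℝ) (v : ℝ × ℝ) : evalP F (r • v) = r ^ k * evalP F v := by
  rw [evalP_eq_sum_monomials, evalP_eq_sum_monomials, Finset.mul_sum]
  refine Finset.sum_congr rfl fun d hd => ?_
  rw [← IsHomogeneous.add_eq hF hd, Prod.smul_fst, Prod.smul_snd, smul_eq_mul, smul_eq_mul]
  ring

theorem IsHomogeneous.evalP_linear {F : MvPolynomial (Fin 2) ℝ} (hF : F.IsHomogeneous 1)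
    (v : ℝ × ℝ) : evalP F v = v.1 * evalP F (1, 0) + v.2 * evalP F (0, 1) := by
  simp only [evalP_eq_sum_monomials, Finset.mul_sum, ← Finset.sum_add_distrib]
  refine Finset.sum_congr rfl fun d hd => ?_
  have := IsHomogeneous.add_eq hF hd
  obtain ⟨h0, h1⟩ | ⟨h0, h1⟩ : (d 0 = 0 ∧ d 1 = 1) ∨ (d 0 = 1 ∧ d 1 = 0) := by omega
  all_goals simp [h0, h1]; try ring

theorem evalP_eq_sum_homogeneousComponent {F : MvPolynomial (Fin 2) ℝ} {n : ℕ}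
    (hF : F.totalDegree ≤ n) (v : ℝ × ℝ) :
    evalP F v = ∑ k ∈ range (n + 1), evalP (homogeneousComponent k F) v := by
  conv_lhs => rw [← sum_homogeneousComponent F]
  rw [evalP, map_sum]
  refine Finset.sum_subset (Finset.range_mono (by omega)) fun k _ hk => ?_
  rw [homogeneousComponent_eq_zero _ _ (by simpa using hk), map_zero]

/-- The restriction of `F` to the line through `b` and `a`, parametrized by `s ↦ b + s • (a - b)`. -/
def segPoly (a b : ℝ × ℝ) (F : MvPolynomial (Fin 2) ℝ) : Polynomial ℝ :=
  aeval ![.X * .C (a.1 - b.1) + .C b.1, .X * .C (a.2 - b.2) + .C b.2] F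

theorem eval_segPoly (a b : ℝ × ℝ) (F : MvPolynomial (Fin 2) ℝ) (s : ℝ) :
    (segPoly a b F).eval s = evalP F (b + s • (a - b)) := by
  unfold evalP segPoly
  change Polynomial.eval s _ = aeval _ F
  rw [← Polynomial.coe_aeval_eq_eval, ← AlgHom.comp_apply, comp_aeval]
  congr 2
  ext i
  fin_cases i <;> simp [add_comm]

theorem segPoly_eq_sum (a b : ℝ × ℝ) (F : MvPolynomial (Fin 2) ℝ) :
    segPoly a b F = ∑ d ∈ F.support, .C (F.coeff d) *
      ((.X * .C (a.1 - b.1) + .C b.1) ^ d 0 * (.X * .C (a.2 - b.2) + .C b.2) ^ d 1) := by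
  rw [segPoly, aeval_def, eval₂_eq']
  simp

theorem IsHomogeneous.natDegree_segPoly_le {F : MvPolynomial (Fin 2) ℝ} {k : ℕ}
    (hF : F.IsHomogeneous k) (a b : ℝ × ℝ) : (segPoly a b F).natDegree ≤ k := by
  rw [segPoly_eq_sum]
  refine Polynomial.natDegree_sum_le_of_forall_le _ _ fun d hd => ?_
  have hl (c e : ℝ) : (.X * .C c + .C e : Polynomial ℝ).natDegree ≤ 1 := by compute_degree
  refine Polynomial.natDegree_C_mul_le _ _ |>.trans (Polynomial.natDegree_mul_le.trans ?_)
  rw [← IsHomogeneous.add_eq hF hd]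
  exact add_le_add
    (Polynomial.natDegree_pow_le.trans ((Nat.mul_le_mul_left _ (hl _ _)).trans_eq (mul_one _)))
    (Polynomial.natDegree_pow_le.trans ((Nat.mul_le_mul_left _ (hl _ _)).trans_eq (mul_one _)))

theorem IsHomogeneous.coeff_segPoly {F : MvPolynomial (Fin 2) ℝ} {k : ℕ}
    (hF : F.IsHomogeneous k) (a b : ℝ × ℝ) : (segPoly a b F).coeff k = evalP F (a - b) := by
  rw [segPoly_eq_sum, evalP_eq_sum_monomials, Polynomial.finsetSum_coeff]
  refine Finset.sum_congr rfl fun d hd => ?_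
  have hl (c e : ℝ) (m : ℕ) : ((.X * .C c + .C e : Polynomial ℝ) ^ m).natDegree ≤ m ∧
      ((.X * .C c + .C e : Polynomial ℝ) ^ m).coeff m = c ^ m := by
    have h1 : (.X * .C c + .C e : Polynomial ℝ).natDegree ≤ 1 := by compute_degree
    refine ⟨Polynomial.natDegree_pow_le.trans ((Nat.mul_le_mul_left _ h1).trans_eq (mul_one _)), ?_⟩
    have := Polynomial.coeff_pow_of_natDegree_le (m := m) h1
    rw [mul_one] at this
    rw [this]
    simp
  rw [← IsHomogeneous.add_eq hF hd, Polynomial.coeff_C_mul,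
    Polynomial.coeff_mul_add_eq_of_natDegree_le (hl _ _ _).1 (hl _ _ _).1, (hl _ _ _).2, (hl _ _ _).2,
    Prod.fst_sub, Prod.snd_sub]

/-- A homogeneous polynomial vanishing on a line that misses the origin is zero. -/
theorem IsHomogeneous.segPoly_ne_zero {F : MvPolynomial (Fin 2) ℝ} {k : ℕ}
    (hF : F.IsHomogeneous k) (hF0 : F ≠ 0) {a b : ℝ × ℝ} (hab : det2 a b ≠ 0) :
    segPoly a b F ≠ 0 := by
  intro h0
  set L : MvPolynomial (Fin 2) ℝ := C (b.2 - a.2) * X 0 + C (a.1 - b.1) * X 1 with hL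
  have hLe (v : ℝ × ℝ) : evalP L v = det2 v b + det2 a v := by
    simp [hL, evalP, det2]; ring
  have hFL : F * L = 0 := by
    refine eq_zero_of_evalP_eq_zero fun v => ?_
    have : evalP (F * L) v = evalP F v * evalP L v := by simp [evalP]
    rw [this, hLe, mul_eq_zero, or_iff_not_imp_right]
    intro hr
    set r := (det2 v b + det2 a v) / det2 a b with hrd
    have hr0 : det2 v b + det2 a v ≠ 0 := hr
    have hv : v = r • (b + (det2 v b / (det2 v b + det2 a v)) • (a - b)) := by
      ext <;> simp only [hrd, Prod.smul_fst, Prod.smul_snd, Prod.fst_add, Prod.snd_add,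
        Prod.fst_sub, Prod.snd_sub, smul_eq_mul] <;> field_simp <;> simp only [det2] <;> ring
    rw [hv, IsHomogeneous.evalP_smul hF, ← eval_segPoly, h0, Polynomial.eval_zero, mul_zero]
  rcases mul_eq_zero.mp hFL with h | h
  · exact hF0 h
  · have h1 := hLe a
    rw [h] at h1
    simp only [evalP, map_zero, det2] at h1 hab
    apply hab
    linarith

end PlanePolynomials

section Triangles

theorem det2_ne_zero_of_affineIndependent {z A B : ℝ × ℝ}
    (h : AffineIndependent ℝ ![z, A, B]) : det2 (A - z) (B - z) ≠ 0 := by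
  intro hd
  rw [affineIndependent_iff] at h
  have key (x y : ℝ) (h1 : x * (A - z).1 + y * (B - z).1 = 0)
      (h2 : x * (A - z).2 + y * (B - z).2 = 0) : x = 0 ∧ y = 0 := by
    have := h univ ![-(x + y), x, y] (by simp [Fin.sum_univ_three]) (by
      simp only [Prod.fst_sub, Prod.snd_sub] at h1 h2
      rw [Fin.sum_univ_three]
      ext <;> simp <;> linarith)
    exact ⟨this 1 (mem_univ _), this 2 (mem_univ _)⟩
  unfold det2 at hd
  have k1 := key (B - z).1 (-(A - z).1) (by ring) (by linarith)
  have k2 := key (B - z).2 (-(A - z).2) (by linarith) (by ring)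
  have k3 := key 1 0 (by linarith [k1.2]) (by linarith [k2.2])
  exact one_ne_zero k3.1

theorem eq_of_smul_add_smul_eq {a b : ℝ × ℝ} (h : det2 a b ≠ 0) {x y x' y' : ℝ}
    (he : x • a + y • b = x' • a + y' • b) : x = x' ∧ y = y' := by
  have h1 := congrArg Prod.fst he
  have h2 := congrArg Prod.snd he
  simp only [Prod.fst_add, Prod.snd_add, Prod.smul_fst, Prod.smul_snd, smul_eq_mul] at h1 h2
  unfold det2 at h
  constructor
  · refine mul_right_cancel₀ h ?_
    linear_combination b.2 * h1 - b.1 * h2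
  · refine mul_right_cancel₀ h ?_
    linear_combination a.1 * h2 - a.2 * h1

theorem mem_tri_iff {z A B p : ℝ × ℝ} (h : AffineIndependent ℝ ![z, A, B]) :
    p ∈ tri z A B ↔ ∃ x y : ℝ, 0 < x ∧ 0 < y ∧ x + y < 1 ∧ p = z + (x • (A - z) + y • (B - z)) := by
  let β : AffineBasis (Fin 3) ℝ (ℝ × ℝ) := ⟨![z, A, B], h, by
    rw [h.affineSpan_eq_top_iff_card_eq_finrank_add_one]; simp⟩
  have hr : Set.range β = {z, A, B} := by
    change Set.range ![z, A, B] = _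
    ext x
    simp [Matrix.range_cons, Matrix.range_empty]
    tauto
  have h0 : β 0 = z := rfl
  have h1 : β 1 = A := rfl
  have h2 : β 2 = B := rfl
  have hs := β.sum_coord_apply_eq_one p
  have hp := β.linear_combination_coord_eq_self p
  rw [Fin.sum_univ_three] at hs hp
  rw [h0, h1, h2] at hp
  have hp' : p = z + (β.coord 1 p • (A - z) + β.coord 2 p • (B - z)) := by
    have hc : β.coord 0 p = 1 - β.coord 1 p - β.coord 2 p := by linarith
    conv_lhs => rw [← hp, hc]
    module
  rw [tri, ← hr, β.interior_convexHull]
  constructor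
  · intro hc
    exact ⟨_, _, hc 1, hc 2, by linarith [hc 0], hp'⟩
  · rintro ⟨x, y, hx, hy, hxy, he⟩
    obtain ⟨e1, e2⟩ := eq_of_smul_add_smul_eq (det2_ne_zero_of_affineIndependent h)
      (add_left_cancel (hp'.symm.trans he))
    intro i
    fin_cases i
    · change 0 < β.coord 0 p
      linarith
    · exact hx.trans_eq e1.symm
    · exact hy.trans_eq e2.symm

/-- Conical parametrization of the triangle with vertices `z`, `z + a`, `z + b`. -/
def coneMap (z a b : ℝ × ℝ) (y : ℝ × ℝ) : ℝ × ℝ := z + y.1 • (b + y.2 • (a - b))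

theorem coneMap_eq (z a b y : ℝ × ℝ) :
    coneMap z a b y = z + ((y.1 * y.2) • a + (y.1 * (1 - y.2)) • b) := by
  unfold coneMap; module

theorem tri_eq_image {z A B : ℝ × ℝ} (h : AffineIndependent ℝ ![z, A, B]) :
    tri z A B = coneMap z (A - z) (B - z) '' (Set.Ioo 0 1 ×ˢ Set.Ioo 0 1) := by
  ext p
  rw [mem_tri_iff h]
  constructor
  · rintro ⟨x, y, hx, hy, hxy, rfl⟩
    have hr : 0 < x + y := by positivity
    refine ⟨(x + y, x / (x + y)), ⟨⟨hr, hxy⟩, by positivity, (div_lt_one hr).mpr (by linarith)⟩, ?_⟩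
    rw [coneMap_eq]
    congr 3 <;> field_simp
    ring
  · rintro ⟨⟨r, s⟩, ⟨⟨hr0, hr1⟩, hs0, hs1⟩, rfl⟩
    have hs2 := sub_pos.mpr hs1
    exact ⟨r * s, r * (1 - s), by positivity, by positivity, by linarith, coneMap_eq _ _ _ _⟩

theorem injOn_coneMap (z : ℝ × ℝ) {a b : ℝ × ℝ} (h : det2 a b ≠ 0) :
    Set.InjOn (coneMap z a b) (Set.Ioo 0 1 ×ˢ Set.Ioo 0 1) := by
  rintro ⟨r, s⟩ ⟨⟨hr0, -⟩, -⟩ ⟨r', s'⟩ - he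
  rw [coneMap_eq, coneMap_eq] at he
  obtain ⟨h1, h2⟩ := eq_of_smul_add_smul_eq h (add_left_cancel he)
  simp only at h1 h2 hr0
  obtain rfl : r = r' := by linarith
  rw [mul_right_inj' hr0.ne'] at h1
  rw [h1]

theorem setIntegral_tri {z A B : ℝ × ℝ} (h : AffineIndependent ℝ ![z, A, B]) (f : ℝ × ℝ → ℝ) :
    ∫ p in tri z A B, f p = |det2 (A - z) (B - z)| *
      ∫ y in Set.Ioo (0 : ℝ) 1 ×ˢ Set.Ioo (0 : ℝ) 1, y.1 * f (coneMap z (A - z) (B - z) y) := by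
  set a := A - z
  set b := B - z
  let D (y : ℝ × ℝ) : ℝ × ℝ →L[ℝ] ℝ × ℝ :=
    (Matrix.toLin (.finTwoProd ℝ) (.finTwoProd ℝ)
      !![b.1 + y.2 * (a.1 - b.1), y.1 * (a.1 - b.1);
        b.2 + y.2 * (a.2 - b.2), y.1 * (a.2 - b.2)]).toContinuousLinearMap
  have hD (y : ℝ × ℝ) : HasFDerivAt (coneMap z a b) (D y) y := by
    simp only [D]
    rw [Matrix.toLin_finTwoProd_toContinuousLinearMap]
    have hc (z b d : ℝ) : HasFDerivAt (fun y : ℝ × ℝ => z + y.1 * (b + y.2 * d))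
        ((b + y.2 * d) • ContinuousLinearMap.fst ℝ ℝ ℝ +
          (y.1 * d) • ContinuousLinearMap.snd ℝ ℝ ℝ) y := by
      have := ((hasFDerivAt_fst (𝕜 := ℝ) (p := y)).mul
        (((hasFDerivAt_snd (𝕜 := ℝ) (p := y)).mul_const d).const_add b)).const_add z
      refine this.congr_fderiv ?_
      ext <;> simp
    exact (hc z.1 b.1 (a.1 - b.1)).prodMk (hc z.2 b.2 (a.2 - b.2))
  have hdet (y : ℝ × ℝ) : (D y).det = -(y.1 * det2 a b) := by
    simp only [D, LinearMap.det_toContinuousLinearMap, LinearMap.det_toLin, Matrix.det_fin_two_of,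
      det2]
    ring
  rw [tri_eq_image h, integral_image_eq_integral_abs_det_fderiv_smul volume
    (measurableSet_Ioo.prod measurableSet_Ioo) (fun y _ => (hD y).hasFDerivWithinAt)
    (injOn_coneMap z (det2_ne_zero_of_affineIndependent h)), ← integral_const_mul]
  refine setIntegral_congr_fun (measurableSet_Ioo.prod measurableSet_Ioo) fun y hy => ?_
  simp only [hdet, abs_neg, abs_mul, abs_of_pos hy.1.1, smul_eq_mul]
  ring

theorem bubble_coneMap {z A B : ℝ × ℝ} (h : det2 (A - z) (B - z) ≠ 0) (y : ℝ × ℝ) :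
    bubble z A B (coneMap z (A - z) (B - z) y) = (1 - y.1) * (y.1 * y.2) * (y.1 * (1 - y.2)) := by
  have e1 : det2 (z - A) (B - A) = -det2 (A - z) (B - z) := by
    simp only [det2, Prod.fst_sub, Prod.snd_sub]; ring
  have e2 : det2 (A - B) (z - B) = -det2 (A - z) (B - z) := by
    simp only [det2, Prod.fst_sub, Prod.snd_sub]; ring
  have e3 : det2 (B - z) (A - z) = -det2 (A - z) (B - z) := by simp only [det2]; ring
  unfold bubble bary
  rw [e1, e2, e3]
  congr 1
  · congr 1
    all_goals
      rw [div_eq_iff (neg_ne_zero.mpr h)]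
      simp only [coneMap, det2, Prod.fst_sub, Prod.snd_sub, Prod.fst_add, Prod.snd_add,
        Prod.smul_fst, Prod.smul_snd, smul_eq_mul]
      ring
  · rw [div_eq_iff (neg_ne_zero.mpr h)]
    simp only [coneMap, det2, Prod.fst_sub, Prod.snd_sub, Prod.fst_add, Prod.snd_add,
      Prod.smul_fst, Prod.smul_snd, smul_eq_mul]
    ring

open Polynomial in
theorem setIntegral_eval_mul_eval (p q : ℝ[X]) :
    ∫ y in Set.Ioo (0 : ℝ) 1 ×ˢ Set.Ioo (0 : ℝ) 1, p.eval y.1 * q.eval y.2 =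
      unitIntegral p * unitIntegral q := by
  rw [unitIntegral_eq_setIntegral, unitIntegral_eq_setIntegral]
  exact setIntegral_prod_mul (fun x => p.eval x) (fun x => q.eval x) _ _

open Polynomial in
theorem integrableOn_eval_mul_eval (p q : ℝ[X]) :
    IntegrableOn (fun y : ℝ × ℝ => p.eval y.1 * q.eval y.2)
      (Set.Ioo (0 : ℝ) 1 ×ˢ Set.Ioo (0 : ℝ) 1) := by
  refine IntegrableOn.mono_set (t := Set.Icc (0 : ℝ) 1 ×ˢ Set.Icc (0 : ℝ) 1) ?_
    (Set.prod_mono Set.Ioo_subset_Icc_self Set.Ioo_subset_Icc_self)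
  refine ContinuousOn.integrableOn_compact (isCompact_Icc.prod isCompact_Icc) ?_
  exact Continuous.continuousOn (by fun_prop)

open MvPolynomial in
/-- The polynomial in `r` whose coefficients are the weighted moments, against `G`, of the
homogeneous components of `U` on the segment from `b` to `a`. -/
def momentPoly (n : ℕ) (a b : ℝ × ℝ) (U : MvPolynomial (Fin 2) ℝ) (G : Polynomial ℝ) :
    Polynomial ℝ :=
  ∑ k ∈ range (n + 1), .C (unitIntegral (.X * (1 - .X) *
    (segPoly a b (homogeneousComponent k U) * G))) * .X ^ k

open MvPolynomial in
theorem coeff_momentPoly {n k : ℕ} (hk : k ≤ n) (a b : ℝ × ℝ) (U : MvPolynomial (Fin 2) ℝ)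
    (G : Polynomial ℝ) : (momentPoly n a b U G).coeff k =
      unitIntegral (.X * (1 - .X) * (segPoly a b (homogeneousComponent k U) * G)) := by
  rw [momentPoly, Polynomial.finsetSum_coeff]
  simp only [Polynomial.coeff_C_mul_X_pow]
  rw [Finset.sum_ite_eq, if_pos (by simpa [Nat.lt_succ_iff] using hk)]

theorem natDegree_momentPoly_le (n : ℕ) (a b : ℝ × ℝ) (U : MvPolynomial (Fin 2) ℝ)
    (G : Polynomial ℝ) : (momentPoly n a b U G).natDegree ≤ n :=
  Polynomial.natDegree_sum_le_of_forall_le _ _ fun _ hk =>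
    (Polynomial.natDegree_C_mul_X_pow_le _ _).trans (Nat.lt_succ_iff.mp (mem_range.mp hk))

open MvPolynomial in
/-- A polynomial equal to `r ^ j * G s * T r` in conical coordinates on a triangle. -/
theorem exists_evalP_coneMap (z : ℝ × ℝ) {a b : ℝ × ℝ} (h : det2 a b ≠ 0) {j : ℕ}
    {G : Polynomial ℝ} (hG : G.natDegree ≤ j) (T : Polynomial ℝ) :
    ∃ w : MvPolynomial (Fin 2) ℝ, w.totalDegree ≤ j + T.natDegree ∧
      ∀ y, evalP w (coneMap z a b y) = y.1 ^ j * G.eval y.2 * T.eval y.1 := by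
  have hlin (α β : ℝ) : ∃ L : MvPolynomial (Fin 2) ℝ, L.totalDegree ≤ 1 ∧
      ∀ v, evalP L v = α * (v.1 - z.1) + β * (v.2 - z.2) := by
    refine ⟨C α * (X 0 - C z.1) + C β * (X 1 - C z.2), ?_, fun v => by simp [evalP]⟩
    have (c e : ℝ) (i : Fin 2) : (C c * (X i - C e) : MvPolynomial (Fin 2) ℝ).totalDegree ≤ 1 := by
      refine (totalDegree_mul _ _).trans ?_
      rw [totalDegree_C, zero_add]
      exact (totalDegree_sub_C_le _ _).trans_eq (totalDegree_X _)
    exact (totalDegree_add _ _).trans (max_le (this _ _ _) (this _ _ _))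
  obtain ⟨L, hL, hLe⟩ := hlin (b.2 / det2 a b) (-b.1 / det2 a b)
  obtain ⟨R, hR, hRe⟩ := hlin ((b.2 - a.2) / det2 a b) ((a.1 - b.1) / det2 a b)
  have hLc (y : ℝ × ℝ) : evalP L (coneMap z a b y) = y.1 * y.2 := by
    rw [hLe]
    field_simp
    simp only [coneMap, det2, Prod.fst_sub, Prod.snd_sub, Prod.fst_add, Prod.snd_add,
      Prod.smul_fst, Prod.smul_snd, smul_eq_mul]
    ring
  have hRc (y : ℝ × ℝ) : evalP R (coneMap z a b y) = y.1 := by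
    rw [hRe]
    field_simp
    simp only [coneMap, det2, Prod.fst_sub, Prod.snd_sub, Prod.fst_add, Prod.snd_add,
      Prod.smul_fst, Prod.smul_snd, smul_eq_mul]
    ring
  have hpow {F : MvPolynomial (Fin 2) ℝ} (hF : F.totalDegree ≤ 1) (m : ℕ) :
      (F ^ m).totalDegree ≤ m :=
    (totalDegree_pow _ _).trans ((Nat.mul_le_mul_left _ hF).trans_eq (mul_one _))
  refine ⟨(∑ m ∈ range (j + 1), C (G.coeff m) * (L ^ m * R ^ (j - m))) *
    ∑ m ∈ range (T.natDegree + 1), C (T.coeff m) * R ^ m, ?_, fun y => ?_⟩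
  · refine (totalDegree_mul _ _).trans (add_le_add ?_ ?_)
    · refine totalDegree_finsetSum_le fun m hm => (totalDegree_mul _ _).trans ?_
      rw [totalDegree_C, zero_add]
      have := (totalDegree_mul (L ^ m) (R ^ (j - m))).trans (add_le_add (hpow hL _) (hpow hR _))
      have := mem_range.mp hm
      omega
    · refine totalDegree_finsetSum_le fun m hm => (totalDegree_mul _ _).trans ?_
      rw [totalDegree_C, zero_add]
      exact (hpow hR m).trans (Nat.lt_succ_iff.mp (mem_range.mp hm))
  · have hLc' := hLc y
    have hRc' := hRc y
    unfold evalP at hLc' hRc' ⊢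
    simp only [map_mul, map_sum, map_pow, eval_C, hLc', hRc']
    rw [Polynomial.eval_eq_sum_range' (Nat.lt_succ_of_le hG), Polynomial.eval_eq_sum_range]
    congr 1
    rw [Finset.mul_sum]
    refine Finset.sum_congr rfl fun m hm => ?_
    rw [← Nat.add_sub_of_le (Nat.lt_succ_iff.mp (mem_range.mp hm)), Nat.add_sub_cancel_left]
    ring

open MvPolynomial in
theorem unitIntegral_momentPoly {n : ℕ} {z A B : ℝ × ℝ} (h : AffineIndependent ℝ ![z, A, B])
    {u : MvPolynomial (Fin 2) ℝ} (hu : u.totalDegree ≤ n)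
    (horth : ∀ w : MvPolynomial (Fin 2) ℝ, w.totalDegree ≤ n - 1 → innerT z A B u w = 0)
    {j : ℕ} {G T : Polynomial ℝ} (hG : G.natDegree ≤ j) (hT : T.natDegree + j < n) :
    unitIntegral (.X ^ 3 * (1 - .X) * (.X ^ j * T *
      momentPoly n (A - z) (B - z) (translateP z u) G)) = 0 := by
  have hd := det2_ne_zero_of_affineIndependent h
  obtain ⟨w, hw, hwe⟩ := exists_evalP_coneMap z hd hG T
  have h0 := horth w (by omega)
  rw [innerT, setIntegral_tri h, mul_eq_zero, or_iff_right (abs_ne_zero.mpr hd)] at h0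
  set a := A - z
  set b := B - z
  set V := fun k => segPoly a b (homogeneousComponent k (translateP z u)) with hV
  have hue (y : ℝ × ℝ) : evalP u (coneMap z a b y) =
      ∑ k ∈ range (n + 1), y.1 ^ k * (V k).eval y.2 := by
    rw [coneMap, ← evalP_translateP,
      evalP_eq_sum_homogeneousComponent (totalDegree_translateP_le z hu)]
    refine Finset.sum_congr rfl fun k _ => ?_
    rw [IsHomogeneous.evalP_smul (homogeneousComponent_isHomogeneous k _), hV, eval_segPoly]
  have hint (y : ℝ × ℝ) : y.1 * (evalP u (coneMap z a b y) * evalP w (coneMap z a b y) *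
      bubble z A B (coneMap z a b y)) = ∑ k ∈ range (n + 1),
        (.X ^ 3 * (1 - .X) * (.X ^ j * T * .X ^ k) : Polynomial ℝ).eval y.1 *
          (.X * (1 - .X) * (V k * G) : Polynomial ℝ).eval y.2 := by
    rw [hue, hwe, bubble_coneMap hd, Finset.sum_mul, Finset.sum_mul, Finset.mul_sum]
    refine Finset.sum_congr rfl fun k _ => ?_
    simp only [Polynomial.eval_mul, Polynomial.eval_pow, Polynomial.eval_X, Polynomial.eval_sub,
      Polynomial.eval_one]
    ring
  simp only [hint] at h0
  rw [integral_finsetSum _ fun _ _ => integrableOn_eval_mul_eval _ _] at h0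
  simp only [setIntegral_eval_mul_eval] at h0
  rw [← h0, momentPoly, Finset.mul_sum, Finset.mul_sum, map_sum]
  refine Finset.sum_congr rfl fun k _ => ?_
  have e (c : ℝ) : (.X ^ 3 * (1 - .X) * (.X ^ j * T * (.C c * .X ^ k)) : Polynomial ℝ) =
      c • (.X ^ 3 * (1 - .X) * (.X ^ j * T * .X ^ k)) := by
    rw [Polynomial.smul_eq_C_mul]; ring
  rw [e, map_smul, smul_eq_mul, mul_comm]

end Triangles

section Patch

open MvPolynomial

theorem unitIntegral_weight_mul_linear (β δ : ℝ) :
    unitIntegral (.X * (1 - .X) * (.C β + .C δ * .X)) = β / 6 + δ / 12 := by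
  have := unitIntegral_derivative (.C (β / 2) * .X ^ 2 + .C ((δ - β) / 3) * .X ^ 3 -
    .C (δ / 4) * .X ^ 4)
  convert this using 1
  · congr 1
    refine Polynomial.funext fun x => ?_
    simp
    ring
  · simp
    ring

theorem segPoly_C (a b : ℝ × ℝ) (c : ℝ) : segPoly a b (C c) = .C c := by
  simp [segPoly]

theorem IsHomogeneous.segPoly_linear {F : MvPolynomial (Fin 2) ℝ} (hF : F.IsHomogeneous 1)
    (a b : ℝ × ℝ) :
    segPoly a b F = .C (evalP F b) + .C (evalP F a - evalP F b) * .X := by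
  refine Polynomial.funext fun s => ?_
  rw [eval_segPoly, IsHomogeneous.evalP_linear hF, IsHomogeneous.evalP_linear hF a,
    IsHomogeneous.evalP_linear hF b]
  simp
  ring

/-- The lowest-order homogeneous component of `u` at `z` is orthogonal, on the segment opposite
to `z`, to all polynomials of lower degree. -/
theorem orthogonal_homogeneousComponent {n k : ℕ} (hk : 1 ≤ k) (hkn : k ≤ n) {z A B : ℝ × ℝ}
    (h : AffineIndependent ℝ ![z, A, B]) {u : MvPolynomial (Fin 2) ℝ} (hu : u.totalDegree ≤ n)
    (horth : ∀ w : MvPolynomial (Fin 2) ℝ, w.totalDegree ≤ n - 1 → innerT z A B u w = 0)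
    (hlow : ∀ m < k, homogeneousComponent m (translateP z u) = 0)
    (G : Polynomial ℝ) (hG : G.natDegree < k) :
    unitIntegral (.X * (1 - .X) *
      (segPoly (A - z) (B - z) (homogeneousComponent k (translateP z u)) * G)) = 0 := by
  rw [← coeff_momentPoly hkn, eq_zero_of_X_pow_dvd (natDegree_momentPoly_le n _ _ _ G)
    (j := k - 1) ?_ fun T hT => unitIntegral_momentPoly h hu horth (by omega) hT,
    Polynomial.coeff_zero]
  rw [Nat.sub_add_cancel hk, Polynomial.X_pow_dvd_iff]
  intro m hm
  rw [coeff_momentPoly (by omega), hlow m hm, segPoly, map_zero, zero_mul, mul_zero, map_zero]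

theorem exists_smul_eq_of_evalP_eq_zero {k : ℕ} {a b : ℝ × ℝ} (hab : det2 a b ≠ 0)
    {H : MvPolynomial (Fin 2) ℝ} (hH : H.IsHomogeneous k) (hH0 : H ≠ 0)
    (h : ∀ G : Polynomial ℝ, G.natDegree < k →
      unitIntegral (.X * (1 - .X) * (segPoly a b H * G)) = 0)
    {p : ℝ × ℝ} (hp0 : p ≠ 0) (hp : evalP H p = 0) :
    ∃ c s : ℝ, c ≠ 0 ∧ s ∈ Set.Ioo (0 : ℝ) 1 ∧ c • p = b + s • (a - b) := by
  have hne := IsHomogeneous.segPoly_ne_zero hH hH0 hab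
  have hdeg := IsHomogeneous.natDegree_segPoly_le hH a b
  set x := det2 p b / det2 a b with hx
  set y := det2 a p / det2 a b with hy
  have hxy : p = x • a + y • b := by
    ext <;> simp only [hx, hy, Prod.fst_add, Prod.snd_add, Prod.smul_fst, Prod.smul_snd,
      smul_eq_mul] <;> field_simp <;> simp only [det2] <;> ring
  rcases eq_or_ne (x + y) 0 with h0 | h0
  · exfalso
    have hpx : p = x • (a - b) := by
      rw [hxy, eq_neg_of_add_eq_zero_right h0]; module
    have hx0 : x ≠ 0 := by
      intro h; rw [h, zero_smul] at hpx; exact hp0 hpx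
    have hc := IsHomogeneous.coeff_segPoly hH a b
    rw [hpx, IsHomogeneous.evalP_smul hH, mul_eq_zero, or_iff_right (pow_ne_zero _ hx0)] at hp
    rw [hp, ← natDegree_eq_of_orthogonal hne hdeg h] at hc
    exact hne (Polynomial.leadingCoeff_eq_zero.mp hc)
  · have hps : p = (x + y) • (b + (x / (x + y)) • (a - b)) := by
      have : (x + y) • (b + (x / (x + y)) • (a - b)) =
          ((x + y) * (x / (x + y))) • a + ((x + y) * (1 - x / (x + y))) • b := by module
      rw [this, mul_one_sub, mul_div_cancel₀ _ h0, add_sub_cancel_left]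
      exact hxy
    refine ⟨(x + y)⁻¹, x / (x + y), inv_ne_zero h0, mem_Ioo_of_isRoot hne hdeg h ?_, ?_⟩
    · rw [hps, IsHomogeneous.evalP_smul hH, mul_eq_zero, or_iff_right (pow_ne_zero _ h0)] at hp
      rw [Polynomial.IsRoot, eval_segPoly, hp]
    · conv_lhs => rw [hps]
      rw [smul_smul, inv_mul_cancel₀ h0, one_smul]

theorem add_smul_sub_ne_zero {a b : ℝ × ℝ} (hab : det2 a b ≠ 0) (s : ℝ) :
    b + s • (a - b) ≠ 0 := by
  intro h
  obtain ⟨h1, h2⟩ := eq_of_smul_add_smul_eq hab (x := s) (y := 1 - s) (x' := 0) (y' := 0)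
    (by rw [zero_smul, zero_smul, add_zero, ← h]; module)
  linarith

namespace TrianglePatch

variable {q : ℕ} (T : TrianglePatch q)

theorem det2_ne_zero (i : ZMod q) : det2 (T.A (i - 1) - T.z) (T.A i - T.z) ≠ 0 :=
  det2_ne_zero_of_affineIndependent (T.indep i)

theorem eq_of_smul_eq {p : ℝ × ℝ} {i j : ZMod q} {c d s t : ℝ} (hs : s ∈ Set.Ioo (0 : ℝ) 1)
    (ht : t ∈ Set.Ioo (0 : ℝ) 1) (hcd : 0 < c * d)
    (hi : c • p = (T.A i - T.z) + s • ((T.A (i - 1) - T.z) - (T.A i - T.z)))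
    (hj : d • p = (T.A j - T.z) + t • ((T.A (j - 1) - T.z) - (T.A j - T.z))) : i = j := by
  by_contra hij
  set ε := 1 / (1 + |c| + |d|) with hε
  have hc0 : 0 < |c| := abs_pos.mpr (left_ne_zero_of_mul hcd.ne')
  have hd0 : 0 < |d| := abs_pos.mpr (right_ne_zero_of_mul hcd.ne')
  have hcomm : |d| * c = |c| * d := by
    rcases pos_and_pos_or_neg_and_neg_of_mul_pos hcd with ⟨h1, h2⟩ | ⟨h1, h2⟩
    · rw [abs_of_pos h1, abs_of_pos h2, mul_comm]
    · rw [abs_of_neg h1, abs_of_neg h2]; ring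
  refine Set.disjoint_left.mp (T.disj hij) (?_ : T.z + (ε * (|d| * c)) • p ∈ _) ?_
  · rw [tri_eq_image (T.indep i)]
    refine ⟨(ε * |d|, s), ⟨⟨by positivity, ?_⟩, hs⟩, ?_⟩
    · simp only [hε]
      rw [one_div, inv_mul_lt_one₀ (by positivity)]
      linarith
    · rw [coneMap, ← hi, smul_smul, mul_assoc]
  · rw [tri_eq_image (T.indep j), hcomm]
    refine ⟨(ε * |c|, t), ⟨⟨by positivity, ?_⟩, ht⟩, ?_⟩
    · simp only [hε]
      rw [one_div, inv_mul_lt_one₀ (by positivity)]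
      linarith
    · rw [coneMap, ← hj, smul_smul, mul_assoc]

/-- No line through `z` meets all the open sectors of a patch. -/
theorem not_forall_exists_smul_eq (p : ℝ × ℝ) :
    ¬ ∀ i : ZMod q, ∃ c s : ℝ, c ≠ 0 ∧ s ∈ Set.Ioo (0 : ℝ) 1 ∧
      c • p = (T.A i - T.z) + s • ((T.A (i - 1) - T.z) - (T.A i - T.z)) := by
  intro h
  choose c s hc hs he using h
  have hcast {m m' : ℕ} (hm : m < 3) (hm' : m' < 3) (hne : m ≠ m') :
      ¬ 0 < c (m : ZMod q) * c (m' : ZMod q) := by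
    intro hpos
    have := T.eq_of_smul_eq (hs _) (hs _) hpos (he _) (he _)
    rw [ZMod.natCast_eq_natCast_iff', Nat.mod_eq_of_lt (hm.trans_le T.hq),
      Nat.mod_eq_of_lt (hm'.trans_le T.hq)] at this
    exact hne this
  have h01 := hcast (m := 0) (m' := 1) (by norm_num) (by norm_num) (by norm_num)
  have h02 := hcast (m := 0) (m' := 2) (by norm_num) (by norm_num) (by norm_num)
  have h12 := hcast (m := 1) (m' := 2) (by norm_num) (by norm_num) (by norm_num)
  rcases (hc (0 : ℕ)).lt_or_gt with h0 | h0 <;> rcases (hc (1 : ℕ)).lt_or_gt with h1 | h1 <;>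
    rcases (hc (2 : ℕ)).lt_or_gt with h2 | h2 <;>
    first
    | exact h01 (mul_pos h0 h1)
    | exact h01 (mul_pos_of_neg_of_neg h0 h1)
    | exact h02 (mul_pos h0 h2)
    | exact h02 (mul_pos_of_neg_of_neg h0 h2)
    | exact h12 (mul_pos h1 h2)
    | exact h12 (mul_pos_of_neg_of_neg h1 h2)

/-- A linear form that is nonnegative on all the edges at `z` vanishes. -/
theorem eq_zero_of_forall_nonneg {c d : ℝ}
    (h : ∀ i : ZMod q, 0 ≤ c * (T.A i - T.z).1 + d * (T.A i - T.z).2) : c = 0 ∧ d = 0 := by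
  obtain ⟨ε, hε, hcov⟩ := T.covers
  let l : ℝ × ℝ → ℝ := fun p => c * (p - T.z).1 + d * (p - T.z).2
  have hl : Continuous l := by fun_prop
  have hhalf (i : ZMod q) : closure (tri T.z (T.A (i - 1)) (T.A i)) ⊆ {p | 0 ≤ l p} := by
    refine closure_minimal (interior_subset.trans (convexHull_min ?_ ?_))
      (isClosed_le continuous_const hl)
    · rintro p (rfl | rfl | rfl)
      · simp [l]
      · exact h (i - 1)
      · exact h i
    · intro p hp p' hp' s t hs ht hst
      have : l (s • p + t • p') = s * l p + t * l p' := by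
        obtain rfl : s = 1 - t := by linarith
        simp [l]
        ring
      change 0 ≤ l _
      rw [this]
      exact add_nonneg (mul_nonneg hs hp) (mul_nonneg ht hp')
  have hlim : Filter.Tendsto (fun t : ℝ => T.z - t • (c, d)) (nhdsWithin 0 (Set.Ioi 0))
      (nhds T.z) := by
    have : Continuous fun t : ℝ => T.z - t • (c, d) := by fun_prop
    simpa using (this.tendsto 0).mono_left nhdsWithin_le_nhds
  obtain ⟨t, htb, ht⟩ := ((hlim.eventually (Metric.ball_mem_nhds _ hε)).and
    self_mem_nhdsWithin).exists
  obtain ⟨i, hi⟩ := Set.mem_iUnion.mp (hcov htb)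
  have h0 : 0 ≤ l (T.z - t • (c, d)) := hhalf i hi
  have h1 : l (T.z - t • (c, d)) = -(t * (c ^ 2 + d ^ 2)) := by
    simp [l]; ring
  rw [h1, neg_nonneg] at h0
  have h2 : c ^ 2 + d ^ 2 ≤ 0 := nonpos_of_mul_nonpos_right h0 ht
  constructor <;> nlinarith [sq_nonneg c, sq_nonneg d]

/-- A linear form having the same mean on all the segments opposite to `z` vanishes. -/
theorem eq_zero_of_add_eq {c d C : ℝ}
    (h : ∀ i : ZMod q, (c * (T.A (i - 1) - T.z).1 + d * (T.A (i - 1) - T.z).2) +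
      (c * (T.A i - T.z).1 + d * (T.A i - T.z).2) = C) : c = 0 ∧ d = 0 := by
  set f : ZMod q → ℝ := fun i => c * (T.A i - T.z).1 + d * (T.A i - T.z).2 with hf
  have hfC (i : ZMod q) : f (i - 1) + f i = C := h i
  have hprod (i : ZMod q) : f (i - 1) * f i = f (0 - 1) * f 0 := by
    have : NeZero q := ⟨by have := T.hq; omega⟩
    rw [← ZMod.natCast_zmod_val i]
    induction i.val with
    | zero => rw [Nat.cast_zero]
    | succ m ih =>
      rw [← ih]
      have := hfC (m + 1)
      rw [Nat.cast_succ, add_sub_cancel_right] at *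
      have e : f (m + 1) = f (m - 1) := by linarith [hfC m]
      rw [e, mul_comm]
  rcases lt_or_ge (f (0 - 1) * f 0) 0 with hD | hD
  · exfalso
    have hcd : 0 < c ^ 2 + d ^ 2 := by
      by_contra! hle
      have hc : c = 0 := by nlinarith [sq_nonneg c, sq_nonneg d]
      have hd : d = 0 := by nlinarith [sq_nonneg c, sq_nonneg d]
      simp [hf, hc, hd] at hD
    refine T.not_forall_exists_smul_eq (-d, c) fun i => ?_
    have hi : f (i - 1) * f i < 0 := (hprod i).trans_lt hD
    have hs : f i / (f i - f (i - 1)) ∈ Set.Ioo (0 : ℝ) 1 := by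
      rcases mul_neg_iff.mp hi with ⟨h1, h2⟩ | ⟨h1, h2⟩
      · exact ⟨div_pos_of_neg_of_neg h2 (by linarith), (div_lt_one_of_neg (by linarith)).mpr
          (by linarith)⟩
      · exact ⟨div_pos h2 (by linarith), (div_lt_one (by linarith)).mpr (by linarith)⟩
    have hne : f i - f (i - 1) ≠ 0 := by
      intro h0; rw [h0, div_zero] at hs; exact lt_irrefl _ hs.1
    set s := f i / (f i - f (i - 1)) with hsd
    have hfs : f i + s * (f (i - 1) - f i) = 0 := by
      rw [hsd]; field_simp; ring
    set v := (T.A i - T.z) + s • ((T.A (i - 1) - T.z) - (T.A i - T.z)) with hv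
    have hlv : c * v.1 + d * v.2 = 0 := by
      rw [← hfs, hv]
      simp only [hf, Prod.fst_add, Prod.snd_add, Prod.smul_fst, Prod.smul_snd, smul_eq_mul,
        Prod.fst_sub, Prod.snd_sub]
      ring
    have hvp : ((c * v.2 - d * v.1) / (c ^ 2 + d ^ 2)) • (-d, c) = v := by
      ext <;> simp only [Prod.smul_mk, smul_eq_mul] <;> field_simp
      · linear_combination (-c) * hlv
      · linear_combination (-d) * hlv
    refine ⟨_, s, ?_, hs, hvp⟩
    intro h0
    rw [h0, zero_smul] at hvp
    exact add_smul_sub_ne_zero (T.det2_ne_zero i) s hvp.symm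
  · rcases le_total 0 C with hC | hC
    · refine T.eq_zero_of_forall_nonneg fun i => ?_
      change 0 ≤ f i
      nlinarith [hfC i, hprod i]
    · have := T.eq_zero_of_forall_nonneg (c := -c) (d := -d) fun i => ?_
      · simpa using this
      · have : 0 ≤ -f i := by nlinarith [hfC i, hprod i]
        simp only [hf] at this
        linarith

end TrianglePatch

end Patch

/-- Let `n ≥ 1` and let `𝒯` be a triangle patch around `z ∈ ℝ²`.
If `u` is a bivariate polynomial of total degree at most `n` whose restriction to each
triangle `K_i` is orthogonal to `P_{n-1}(K_i)` w.r.t. `(·,·)_{K_i}`, then `u = 0`;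
i.e. `⋂_i P_{n-1}^⊥(K_i) = {0}`. -/
theorem statement0 (n q : ℕ) (hn : 1 ≤ n) (T : TrianglePatch q)
    (u : MvPolynomial (Fin 2) ℝ) (hu : u.totalDegree ≤ n)
    (horth : ∀ i : ZMod q, ∀ w : MvPolynomial (Fin 2) ℝ, w.totalDegree ≤ n - 1 →
      innerT T.z (T.A (i - 1)) (T.A i) u w = 0) :

    u = 0 := by
  by_contra hne
  set U := translateP T.z u with hU
  have hex : ∃ k, MvPolynomial.homogeneousComponent k U ≠ 0 := by
    by_contra! hall
    refine hne (eq_zero_of_translateP_eq_zero (z := T.z) ?_)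
    rw [← MvPolynomial.sum_homogeneousComponent (translateP T.z u)]
    exact Finset.sum_eq_zero fun k _ => hall k
  classical
  obtain ⟨k, hk, hlow⟩ : ∃ k, MvPolynomial.homogeneousComponent k U ≠ 0 ∧
      ∀ m < k, MvPolynomial.homogeneousComponent m U = 0 :=
    ⟨Nat.find hex, Nat.find_spec hex, fun m hm => not_not.mp (Nat.find_min hex hm)⟩
  have hkn : k ≤ n := by
    by_contra! hlt
    exact hk (MvPolynomial.homogeneousComponent_eq_zero _ _
      ((totalDegree_translateP_le T.z hu).trans_lt hlt))
  have hhom (m : ℕ) := MvPolynomial.homogeneousComponent_isHomogeneous m U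
  rcases Nat.eq_zero_or_pos k with rfl | hk1
  · rw [MvPolynomial.homogeneousComponent_zero, MvPolynomial.C_ne_zero] at hk
    let P (i : ZMod q) := momentPoly n (T.A (i - 1) - T.z) (T.A i - T.z) U 1
    have hP (i : ZMod q) (S : Polynomial ℝ) (hS : S.natDegree < n) :
        unitIntegral (.X ^ 3 * (1 - .X) * (S * P i)) = 0 := by
      have := unitIntegral_momentPoly (j := 0) (G := 1) (T := S) (T.indep i) hu (horth i)
        (by simp) (by simpa using hS)
      rwa [pow_zero, one_mul] at this
    have hcoeff0 (i : ZMod q) : (P i).coeff 0 = U.coeff 0 / 6 := by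
      have := unitIntegral_weight_mul_linear (U.coeff 0) 0
      rw [map_zero, zero_mul, add_zero, zero_div, add_zero] at this
      rw [coeff_momentPoly (Nat.zero_le n), MvPolynomial.homogeneousComponent_zero, segPoly_C,
        mul_one, this]
    have hcoeff1 (i : ZMod q) : (P i).coeff 1 =
        (evalP (MvPolynomial.homogeneousComponent 1 U) (T.A (i - 1) - T.z) +
          evalP (MvPolynomial.homogeneousComponent 1 U) (T.A i - T.z)) / 12 := by
      rw [coeff_momentPoly hn, IsHomogeneous.segPoly_linear (hhom 1), mul_one,
        unitIntegral_weight_mul_linear]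
      ring
    have hPeq (i : ZMod q) : P i = P 0 := by
      refine sub_eq_zero.mp (eq_zero_of_X_pow_dvd (n := n) (j := 0) ?_ ?_ fun S hS => ?_)
      · exact (Polynomial.natDegree_sub_le _ _).trans
          (max_le (natDegree_momentPoly_le _ _ _ _ _) (natDegree_momentPoly_le _ _ _ _ _))
      · rw [zero_add, pow_one, Polynomial.X_dvd_iff, Polynomial.coeff_sub, hcoeff0, hcoeff0,
          sub_self]
      · rw [pow_zero, one_mul, mul_sub S, mul_sub (.X ^ 3 * (1 - .X) : Polynomial ℝ), map_sub, hP i S hS, hP 0 S hS, sub_self]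
    obtain ⟨h10, h01⟩ := T.eq_zero_of_add_eq
      (c := evalP (MvPolynomial.homogeneousComponent 1 U) (1, 0))
      (d := evalP (MvPolynomial.homogeneousComponent 1 U) (0, 1))
      (C := 12 * (P 0).coeff 1) fun i => by
        rw [← hPeq i, hcoeff1, IsHomogeneous.evalP_linear (hhom 1) (T.A (i - 1) - T.z),
          IsHomogeneous.evalP_linear (hhom 1) (T.A i - T.z)]
        ring
    have hP0 : P 0 = 0 := by
      refine eq_zero_of_coeff_one_eq_zero hn (natDegree_momentPoly_le _ _ _ _ _) ?_ (hP 0)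
      rw [hcoeff1, IsHomogeneous.evalP_linear (hhom 1), h10, h01,
        IsHomogeneous.evalP_linear (hhom 1), h10, h01]
      ring
    have := hcoeff0 0
    rw [hP0, Polynomial.coeff_zero] at this
    exact hk (by linarith)
  · have horth' (i : ZMod q) := orthogonal_homogeneousComponent hk1 hkn (T.indep i) hu (horth i) hlow
    have hone := horth' 0 1 (by simpa using hk1)
    rw [mul_one (segPoly _ _ _)] at hone
    obtain ⟨s, -, hs⟩ := exists_root_of_orthogonal_one hone
    rw [eval_segPoly] at hs
    exact T.not_forall_exists_smul_eq _ fun i => exists_smul_eq_of_evalP_eq_zero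
      (T.det2_ne_zero i) (hhom k) hk (horth' i) (add_smul_sub_ne_zero (T.det2_ne_zero 0) s) hs
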